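/- arXiv:1207.5780 — 2 statements merged into one kernel-verified Lean document; each statement's English description precedes it below -/
import Mathlib

section
/- For every p : I → k: the k-algebra of A-module endomorphisms of P(p) is one-dimensional over k (every endomorphism is a scalar), hence P(p) is indecomposable; moreover the sum N(p) of all A-submodules S ⊆ P(p) with S ∩ P(p)_p = 0 is a proper submodule containing every proper A-submodule of P(p), i.e. P(p) has a unique maximal proper submodule. -/
set_option synthInstance.maxHeartbeats 1000000
set_option maxHeartbeats 4000000

noncomputable section

open MvPolynomial

universe u v

variable (k : Type u) (I : Type v) [Field k]

/-- Multiplication by the variable `x i` on the polynomial algebra `B`. -/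
def Xop (i : I) : Module.End k (MvPolynomial I k) :=
  LinearMap.mulLeft k (MvPolynomial.X i)

/-- The partial derivative `∂/∂x i` on the polynomial algebra `B`. -/
def Yop (i : I) : Module.End k (MvPolynomial I k) :=
  (MvPolynomial.pderiv i).toLinearMap

/-- The infinite Weyl algebra `A`: the subalgebra of `Module.End k B` generated by
all `X i` and `Y i`. -/
def Weyl : Subalgebra k (Module.End k (MvPolynomial I k)) :=
  Algebra.adjoin k (Set.range (Xop k I) ∪ Set.range (Yop k I))

instance : Ring (Weyl k I) := inferInstance
instance : Algebra k (Weyl k I) := inferInstance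

/-- `X i` as an element of the Weyl algebra. -/
def XA (i : I) : Weyl k I :=
  ⟨Xop k I i, Algebra.subset_adjoin (Set.mem_union_left _ ⟨i, rfl⟩)⟩

/-- `Y i` as an element of the Weyl algebra. -/
def YA (i : I) : Weyl k I :=
  ⟨Yop k I i, Algebra.subset_adjoin (Set.mem_union_right _ ⟨i, rfl⟩)⟩

/-- `t i = X i * Y i` as an element of the Weyl algebra. -/
def tA (i : I) : Weyl k I := XA k I i * YA k I i

/-- Shortcut instance: quotients of the Weyl algebra by left ideals (submodules). -/
instance : HasQuotient (Weyl k I) (Submodule (Weyl k I) (Weyl k I)) :=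
  @Submodule.hasQuotient (Weyl k I) (Weyl k I) _ _ _

/-- The weight space of weight `p` in a module over the Weyl algebra:
all `x` with `t i • x = p i • x` for every `i`. -/
def wtSp (M : Type*) [AddCommGroup M] [Module k M] [Module (Weyl k I) M]
    [IsScalarTower k (Weyl k I) M] (p : I → k) : Submodule k M where
  carrier := {x | ∀ i, tA k I i • x = p i • x}
  add_mem' := by
    intro a b ha hb i
    rw [smul_add, ha i, hb i, ← smul_add]
  zero_mem' := by intro i; rw [smul_zero, smul_zero]
  smul_mem' := by
    intro c x hx i
    have h : tA k I i • (c • x) = c • (tA k I i • x) := by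
      rw [← algebraMap_smul (Weyl k I) c x, ← algebraMap_smul (Weyl k I) c (tA k I i • x),
        smul_smul, smul_smul, Algebra.commutes]
    rw [h, hx i, smul_smul, smul_smul, mul_comm]

/-- The left ideal `J_p` of the Weyl algebra generated by the elements `t i - p i • 1`. -/
def Jp (p : I → k) : Submodule (Weyl k I) (Weyl k I) :=
  Submodule.span (Weyl k I) (Set.range fun i => tA k I i - p i • (1 : Weyl k I))

/-- The sum `N(p)` of all submodules of `P(p)` intersecting the weight space `P(p)_p`
trivially. -/
def Np (p : I → k) : Submodule (Weyl k I) (Weyl k I ⧸ Jp k I p) :=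
  sSup {S : Submodule (Weyl k I) (Weyl k I ⧸ Jp k I p) |
    ∀ x ∈ S, x ∈ wtSp k I (Weyl k I ⧸ Jp k I p) p → x = 0}

variable {k I}

theorem weyl_induction {C : Weyl k I → Prop} (hX : ∀ i, C (XA k I i)) (hY : ∀ i, C (YA k I i))
    (halg : ∀ c : k, C (algebraMap k (Weyl k I) c)) (hadd : ∀ a b, C a → C b → C (a + b))
    (hmul : ∀ a b, C a → C b → C (a * b)) (a : Weyl k I) : C a := by
  obtain ⟨a, ha⟩ := a
  induction ha using Algebra.adjoin_induction with
  | mem x hx =>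
    rcases hx with ⟨i, rfl⟩ | ⟨i, rfl⟩
    · exact hX i
    · exact hY i
  | algebraMap c => exact halg c
  | add x y hx hy h₁ h₂ => exact hadd ⟨x, hx⟩ ⟨y, hy⟩ h₁ h₂
  | mul x y hx hy h₁ h₂ => exact hmul ⟨x, hx⟩ ⟨y, hy⟩ h₁ h₂

theorem Xop_apply (i : I) (q : MvPolynomial I k) : Xop k I i q = X i * q := rfl

theorem Yop_apply (i : I) (q : MvPolynomial I k) : Yop k I i q = pderiv i q := rfl

theorem pderiv_comm (i j : I) (q : MvPolynomial I k) :
    pderiv i (pderiv j q) = pderiv j (pderiv i q) := by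
  have h : ⁅(pderiv i : Derivation k (MvPolynomial I k) (MvPolynomial I k)),
      (pderiv j : Derivation k (MvPolynomial I k) (MvPolynomial I k))⁆ = 0 := by
    classical
    refine MvPolynomial.derivation_ext fun l => ?_
    rw [Derivation.commutator_apply, pderiv_X, pderiv_X, Pi.single_apply, Pi.single_apply]
    split_ifs <;> simp
  have := congr($h q)
  rwa [Derivation.commutator_apply, Derivation.zero_apply, sub_eq_zero] at this

theorem XA_mul_XA (i j : I) : XA k I i * XA k I j = XA k I j * XA k I i := by
  have h : Xop k I i * Xop k I j = Xop k I j * Xop k I i := LinearMap.ext fun q => by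
    simp only [Module.End.mul_apply, Xop_apply, mul_left_comm]
  exact Subtype.ext h

theorem YA_mul_YA (i j : I) : YA k I i * YA k I j = YA k I j * YA k I i := by
  have h : Yop k I i * Yop k I j = Yop k I j * Yop k I i := LinearMap.ext fun q => by
    simp only [Module.End.mul_apply, Yop_apply, pderiv_comm i j]
  exact Subtype.ext h

theorem YA_mul_XA_self (i : I) : YA k I i * XA k I i = XA k I i * YA k I i + 1 := by
  have h : Yop k I i * Xop k I i = Xop k I i * Yop k I i + 1 := LinearMap.ext fun q => by
    simp only [Module.End.mul_apply, Yop_apply, Xop_apply, LinearMap.add_apply,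
      Module.End.one_apply, pderiv_mul, pderiv_X_self, one_mul]
    exact add_comm _ _
  exact Subtype.ext h

theorem YA_mul_XA_of_ne {i j : I} (hij : i ≠ j) :
    YA k I i * XA k I j = XA k I j * YA k I i := by
  have h : Yop k I i * Xop k I j = Xop k I j * Yop k I i := LinearMap.ext fun q => by
    simp only [Module.End.mul_apply, Yop_apply, Xop_apply, pderiv_mul, pderiv_X_of_ne hij.symm,
      zero_mul, zero_add]
  exact Subtype.ext h

/-- The coefficient of `x ^ (m + n)` in `a (x ^ m)` is a polynomial function of `m`. -/
def HasPolynomialCoeffs (a : Module.End k (MvPolynomial I k)) : Prop :=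
  ∀ n : I → ℤ, ∃ F : MvPolynomial I k, ∀ m m' : I →₀ ℕ, (∀ j, (m' j : ℤ) = m j + n j) →
    coeff m' (a (monomial m 1)) = eval (fun j => (m j : k)) F

theorem hasPolynomialCoeffs_one : HasPolynomialCoeffs (1 : Module.End k (MvPolynomial I k)) := by
  classical
  intro n
  refine ⟨if n = 0 then 1 else 0, fun m m' h => ?_⟩
  have : m = m' ↔ n = 0 := by
    simp only [Finsupp.ext_iff, funext_iff, Pi.zero_apply]
    exact forall_congr' fun j => by grind
  rw [Module.End.one_apply, coeff_monomial]
  split_ifs <;> simp_all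

theorem HasPolynomialCoeffs.add {a b : Module.End k (MvPolynomial I k)}
    (ha : HasPolynomialCoeffs a) (hb : HasPolynomialCoeffs b) : HasPolynomialCoeffs (a + b) := by
  intro n
  obtain ⟨F, hF⟩ := ha n
  obtain ⟨G, hG⟩ := hb n
  exact ⟨F + G, fun m m' h => by simp [hF m m' h, hG m m' h]⟩

theorem HasPolynomialCoeffs.smul {a : Module.End k (MvPolynomial I k)}
    (ha : HasPolynomialCoeffs a) (c : k) : HasPolynomialCoeffs (c • a) := by
  intro n
  obtain ⟨F, hF⟩ := ha n
  exact ⟨C c * F, fun m m' h => by simp [hF m m' h]⟩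

theorem HasPolynomialCoeffs.mul_Xop {a : Module.End k (MvPolynomial I k)}
    (ha : HasPolynomialCoeffs a) (i : I) : HasPolynomialCoeffs (a * Xop k I i) := by
  intro n
  obtain ⟨F, hF⟩ := ha (n - ⇑(Finsupp.single i (1 : ℤ)))
  refine ⟨bind₁ (fun j => X j + C (Finsupp.single i (1 : k) j)) F, fun m m' h => ?_⟩
  have hX : Xop k I i (monomial m 1) = monomial (m + Finsupp.single i 1) 1 := by
    rw [Xop_apply, X, monomial_mul, add_comm, one_mul]
  rw [Module.End.mul_apply, hX, hF _ _ fun j => ?_]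
  · simp only [eval, eval₂Hom_bind₁]
    congr 2
    funext j
    classical
    by_cases hj : i = j <;> simp [hj]
  · classical
    have := h j
    simp only [Finsupp.add_apply, Pi.sub_apply, Finsupp.single_apply]
    grind

theorem HasPolynomialCoeffs.mul_Yop {a : Module.End k (MvPolynomial I k)}
    (ha : HasPolynomialCoeffs a) (i : I) : HasPolynomialCoeffs (a * Yop k I i) := by
  intro n
  obtain ⟨F, hF⟩ := ha (n + ⇑(Finsupp.single i (1 : ℤ)))
  refine ⟨X i * bind₁ (fun j => X j - C (Finsupp.single i (1 : k) j)) F, fun m m' h => ?_⟩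
  have hY : Yop k I i (monomial m 1) = (m i : k) • monomial (m - Finsupp.single i 1) 1 := by
    rw [Yop_apply, pderiv_monomial, smul_monomial, one_mul, smul_eq_mul, mul_one]
  rw [Module.End.mul_apply, hY, map_smul, coeff_smul, smul_eq_mul, map_mul, eval_X]
  rcases Nat.eq_zero_or_pos (m i) with h0 | h0
  · simp [h0]
  rw [hF _ _ fun j => ?_]
  · congr 1
    simp only [eval, eval₂Hom_bind₁]
    congr 2
    funext j
    classical
    by_cases hj : i = j
    · subst hj
      simp [Nat.cast_sub (show 1 ≤ m i from h0)]
    · simp [hj]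
  · classical
    have := h j
    simp only [Finsupp.tsub_apply, Pi.add_apply, Finsupp.single_apply]
    grind

theorem hasPolynomialCoeffs (a : Weyl k I) :
    HasPolynomialCoeffs (a : Module.End k (MvPolynomial I k)) := by
  suffices h : ∀ b : Module.End k (MvPolynomial I k), HasPolynomialCoeffs b →
      HasPolynomialCoeffs (b * (a : Module.End k (MvPolynomial I k))) by
    simpa using h 1 hasPolynomialCoeffs_one
  induction a using weyl_induction with
  | hX i => exact fun b hb => hb.mul_Xop i
  | hY i => exact fun b hb => hb.mul_Yop i
  | halg c =>
    intro b hb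
    have : b * ((algebraMap k (Weyl k I) c : Weyl k I) : Module.End k (MvPolynomial I k)) =
        c • b := by
      change b * algebraMap k (Module.End k (MvPolynomial I k)) c = _
      rw [← Algebra.commutes, Algebra.smul_def]
    rw [this]
    exact hb.smul c
  | hadd x y hx hy =>
    intro b hb
    rw [Subalgebra.coe_add, mul_add]
    exact (hx b hb).add (hy b hb)
  | hmul x y hx hy =>
    intro b hb
    rw [Subalgebra.coe_mul, ← mul_assoc]
    exact hy _ (hx b hb)

theorem exists_diagonal_polynomial (a : Weyl k I) : ∃ F : MvPolynomial I k, ∀ m : I →₀ ℕ,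
    coeff m ((a : Module.End k (MvPolynomial I k)) (monomial m 1)) = eval (fun j => (m j : k)) F := by
  obtain ⟨F, hF⟩ := hasPolynomialCoeffs a 0
  exact ⟨F, fun m => hF m m (by simp)⟩

theorem eq_of_eval_natCast_eq [CharZero k] {F G : MvPolynomial I k}
    (h : ∀ m : I →₀ ℕ, eval (fun j => (m j : k)) F = eval (fun j => (m j : k)) G) : F = G := by
  classical
  refine funext_set (fun _ => Set.range (Nat.cast : ℕ → k))
    (fun _ => Set.infinite_range_of_injective Nat.cast_injective) fun x hx => ?_
  choose f hf using fun j => hx j (Set.mem_univ j)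
  set m : I →₀ ℕ := Finsupp.indicator (F.vars ∪ G.vars) fun j _ => f j
  have hm : ∀ j ∈ F.vars ∪ G.vars, (m j : k) = x j := fun j hj => by
    rw [← hf j, Finsupp.indicator_of_mem hj]
  calc eval x F = eval (fun j => (m j : k)) F :=
        eval₂Hom_congr' rfl (fun j hj _ => (hm j (Finset.mem_union_left _ hj)).symm) rfl
    _ = eval (fun j => (m j : k)) G := h m
    _ = eval x G := eval₂Hom_congr' rfl (fun j hj _ => hm j (Finset.mem_union_right _ hj)) rfl

theorem tA_apply (i : I) (q : MvPolynomial I k) :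
    (tA k I i : Module.End k (MvPolynomial I k)) q = X i * pderiv i q := rfl

theorem tA_monomial (i : I) (m : I →₀ ℕ) :
    (tA k I i : Module.End k (MvPolynomial I k)) (monomial m 1) = (m i : k) • monomial m 1 := by
  rw [tA_apply, X_mul_pderiv_monomial, Nat.cast_smul_eq_nsmul]

theorem coeff_tA_apply (i : I) (m : I →₀ ℕ) (q : MvPolynomial I k) :
    coeff m ((tA k I i : Module.End k (MvPolynomial I k)) q) = m i * coeff m q := by
  classical
  rw [tA_apply, coeff_X_mul', coeff_pderiv]
  split_ifs with h
  · have h1 : Finsupp.single i 1 ≤ m :=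
      Finsupp.single_le_iff.2 (Nat.one_le_iff_ne_zero.2 (Finsupp.mem_support_iff.1 h))
    have h2 := Finsupp.single_le_iff.1 h1
    rw [tsub_add_cancel_of_le h1, mul_comm, Finsupp.tsub_apply, Finsupp.single_eq_same,
      Nat.cast_sub h2, Nat.cast_one, sub_add_cancel]
  · simp [Finsupp.notMem_support_iff.1 h]

/-- Evaluating at `p` the polynomial of diagonal coefficients gives a functional on the Weyl algebra
on which each `t i` acts, from either side, as the scalar `p i`. -/
theorem exists_weight_functional [CharZero k] (p : I → k) :
    ∃ φ : Weyl k I →ₗ[k] k, φ 1 = 1 ∧ (∀ a i, φ (a * tA k I i) = p i * φ a) ∧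
      ∀ a i, φ (tA k I i * a) = p i * φ a := by
  choose F hF using exists_diagonal_polynomial (k := k) (I := I)
  refine ⟨{ toFun := fun a => eval p (F a), map_add' := fun a b => ?_, map_smul' := fun c a => ?_ },
    ?_, fun a i => ?_, fun a i => ?_⟩
  · rw [← map_add]
    congr 1
    refine eq_of_eval_natCast_eq fun m => ?_
    rw [map_add, ← hF, ← hF, ← hF, Subalgebra.coe_add, LinearMap.add_apply, coeff_add]
  · have : F (c • a) = C c * F a := eq_of_eval_natCast_eq fun m => by
      rw [map_mul, eval_C, ← hF, ← hF, Subalgebra.coe_smul, LinearMap.smul_apply, coeff_smul,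
        smul_eq_mul]
    simp [this]
  · have : F 1 = 1 := eq_of_eval_natCast_eq fun m => by
      classical
      rw [map_one, ← hF, Subalgebra.coe_one, Module.End.one_apply, coeff_monomial, if_pos rfl]
    simp [this]
  · have : F (a * tA k I i) = X i * F a := eq_of_eval_natCast_eq fun m => by
      rw [map_mul, eval_X, ← hF, ← hF, Subalgebra.coe_mul, Module.End.mul_apply, tA_monomial,
        map_smul, coeff_smul, smul_eq_mul]
    simp [this]
  · have : F (tA k I i * a) = X i * F a := eq_of_eval_natCast_eq fun m => by
      rw [map_mul, eval_X, ← hF, ← hF, Subalgebra.coe_mul, Module.End.mul_apply, coeff_tA_apply]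
    simp [this]

theorem exists_weight_functional_quotient [CharZero k] (p : I → k) :
    ∃ φ : (Weyl k I ⧸ Jp k I p) →ₗ[k] k, φ ((Jp k I p).mkQ 1) = 1 ∧
      ∀ i x, φ (tA k I i • x) = p i * φ x := by
  obtain ⟨φ, h1, hr, hl⟩ := exists_weight_functional p
  have hJ : ∀ x ∈ Jp k I p, ∀ b, φ (b * x) = 0 := by
    intro x hx
    refine Submodule.span_induction ?_ ?_ ?_ ?_ hx
    · rintro _ ⟨i, rfl⟩ b
      rw [mul_sub, map_sub, hr, mul_smul_comm, mul_one, map_smul, smul_eq_mul, sub_self]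
    · intro b
      rw [mul_zero, map_zero]
    · intro x y _ _ hx hy b
      rw [mul_add, map_add, hx, hy, add_zero]
    · intro a x _ hx b
      rw [smul_eq_mul, ← mul_assoc, hx]
  have hker : (Jp k I p).restrictScalars k ≤ LinearMap.ker φ := fun x hx => by
    rw [LinearMap.mem_ker, ← one_mul x, hJ x hx]
  refine ⟨(((Jp k I p).restrictScalars k).liftQ φ hker).comp
    (Submodule.Quotient.restrictScalarsEquiv k (Jp k I p)).symm.toLinearMap, h1, fun i x => ?_⟩
  obtain ⟨a, rfl⟩ := (Jp k I p).mkQ_surjective x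
  exact hl a i

theorem tA_mul_XA_self (i : I) : tA k I i * XA k I i = XA k I i * tA k I i + XA k I i := by
  rw [tA, mul_assoc, YA_mul_XA_self, mul_add, mul_one]

theorem tA_mul_YA_self (i : I) : tA k I i * YA k I i = YA k I i * tA k I i - YA k I i := by
  rw [tA, ← mul_assoc (YA k I i), YA_mul_XA_self, add_mul, one_mul, add_sub_cancel_right]

theorem tA_mul_XA_of_ne {i j : I} (h : i ≠ j) : tA k I i * XA k I j = XA k I j * tA k I i := by
  rw [tA, mul_assoc, YA_mul_XA_of_ne h, ← mul_assoc, XA_mul_XA, mul_assoc]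

theorem tA_mul_YA_of_ne {i j : I} (h : i ≠ j) : tA k I i * YA k I j = YA k I j * tA k I i := by
  rw [tA, mul_assoc, YA_mul_YA, ← mul_assoc, ← YA_mul_XA_of_ne h.symm, mul_assoc]

theorem tA_mul_tA (i j : I) : tA k I i * tA k I j = tA k I j * tA k I i := by
  by_cases h : i = j
  · rw [h]
  · conv_lhs => rw [tA.eq_1 k I j]
    rw [← mul_assoc, tA_mul_XA_of_ne h, mul_assoc, tA_mul_YA_of_ne h, ← mul_assoc, ← tA]

variable {M : Type*} [AddCommGroup M] [Module (Weyl k I) M]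

/-- `IsMonomial x y v₀ n v` says that `v` is obtained from `v₀` by a product of `n i` factors `x i`
for each `i` with `0 ≤ n i` and of `-n i` factors `y i` for each `i` with `n i ≤ 0`. -/
inductive IsMonomial {I A M : Type*} [Monoid A] [MulAction A M] (x y : I → A) (v₀ : M) :
    (I →₀ ℤ) → M → Prop
  | base : IsMonomial x y v₀ 0 v₀
  | X_smul {n : I →₀ ℤ} {v : M} (i : I) (h : 0 ≤ n i) (hv : IsMonomial x y v₀ n v) :
      IsMonomial x y v₀ (n + Finsupp.single i 1) (x i • v)
  | Y_smul {n : I →₀ ℤ} {v : M} (i : I) (h : n i ≤ 0) (hv : IsMonomial x y v₀ n v) :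
      IsMonomial x y v₀ (n - Finsupp.single i 1) (y i • v)

namespace IsMonomial

variable {v₀ v : M} {n : I →₀ ℤ}

theorem eq_of_eq_zero (h : IsMonomial (XA k I) (YA k I) v₀ n v) (hn : n = 0) : v = v₀ := by
  cases h with
  | base => rfl
  | @X_smul n v i h hv =>
    have := DFunLike.congr_fun hn i
    simp only [Finsupp.add_apply, Finsupp.single_eq_same, Finsupp.zero_apply] at this
    omega
  | @Y_smul n v i h hv =>
    have := DFunLike.congr_fun hn i
    simp only [Finsupp.sub_apply, Finsupp.single_eq_same, Finsupp.zero_apply] at this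
    omega

theorem exists_eq_X_smul (h : IsMonomial (XA k I) (YA k I) v₀ n v) {i : I} (hi : 0 < n i) :
    ∃ w, IsMonomial (XA k I) (YA k I) v₀ (n - Finsupp.single i 1) w ∧ v = XA k I i • w := by
  induction h with
  | base => simp at hi
  | @X_smul n v j h hv ih =>
    by_cases hij : i = j
    · subst hij
      exact ⟨v, by simpa using hv, rfl⟩
    · obtain ⟨w, hw, rfl⟩ := ih (by simpa [Finsupp.single_eq_of_ne hij] using hi)
      refine ⟨XA k I j • w, ?_, ?_⟩
      · rw [add_sub_right_comm]
        exact hw.X_smul j (by simpa [Finsupp.single_eq_of_ne (Ne.symm hij)] using h)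
      · rw [← mul_smul, XA_mul_XA, mul_smul]
  | @Y_smul n v j h hv ih =>
    have hij : i ≠ j := by
      rintro rfl
      simp only [Finsupp.sub_apply, Finsupp.single_eq_same] at hi
      omega
    obtain ⟨w, hw, rfl⟩ := ih (by simpa [Finsupp.single_eq_of_ne hij] using hi)
    refine ⟨YA k I j • w, ?_, ?_⟩
    · rw [sub_right_comm]
      exact hw.Y_smul j (by simpa [Finsupp.single_eq_of_ne (Ne.symm hij)] using h)
    · rw [← mul_smul, YA_mul_XA_of_ne (Ne.symm hij), mul_smul]

theorem exists_eq_Y_smul (h : IsMonomial (XA k I) (YA k I) v₀ n v) {i : I} (hi : n i < 0) :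
    ∃ w, IsMonomial (XA k I) (YA k I) v₀ (n + Finsupp.single i 1) w ∧ v = YA k I i • w := by
  induction h with
  | base => simp at hi
  | @X_smul n v j h hv ih =>
    have hij : i ≠ j := by
      rintro rfl
      simp only [Finsupp.add_apply, Finsupp.single_eq_same] at hi
      omega
    obtain ⟨w, hw, rfl⟩ := ih (by simpa [Finsupp.single_eq_of_ne hij] using hi)
    refine ⟨XA k I j • w, ?_, ?_⟩
    · rw [add_right_comm]
      exact hw.X_smul j (by simpa [Finsupp.single_eq_of_ne (Ne.symm hij)] using h)
    · rw [← mul_smul, ← YA_mul_XA_of_ne hij, mul_smul]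
  | @Y_smul n v j h hv ih =>
    by_cases hij : i = j
    · subst hij
      exact ⟨v, by simpa using hv, rfl⟩
    · obtain ⟨w, hw, rfl⟩ := ih (by simpa [Finsupp.single_eq_of_ne hij] using hi)
      refine ⟨YA k I j • w, ?_, ?_⟩
      · rw [sub_add_eq_add_sub]
        exact hw.Y_smul j (by simpa [Finsupp.single_eq_of_ne (Ne.symm hij)] using h)
      · rw [← mul_smul, YA_mul_YA, mul_smul]

end IsMonomial

variable [Module k M] [IsScalarTower k (Weyl k I) M]

theorem XA_smul_mem_wtSp {p q : I → k} {x : M} (hx : x ∈ wtSp k I M p) (i : I)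
    (hi : q i = p i + 1) (hq : ∀ j, j ≠ i → q j = p j) : XA k I i • x ∈ wtSp k I M q := by
  intro j
  rw [← mul_smul]
  by_cases h : j = i
  · subst h
    rw [tA_mul_XA_self, add_smul, mul_smul, hx j, hi, add_smul, one_smul, smul_comm]
  · rw [tA_mul_XA_of_ne h, mul_smul, hx j, hq j h, smul_comm]

theorem YA_smul_mem_wtSp {p q : I → k} {x : M} (hx : x ∈ wtSp k I M p) (i : I)
    (hi : q i = p i - 1) (hq : ∀ j, j ≠ i → q j = p j) : YA k I i • x ∈ wtSp k I M q := by
  intro j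
  rw [← mul_smul]
  by_cases h : j = i
  · subst h
    rw [tA_mul_YA_self, sub_smul, mul_smul, hx j, hi, sub_smul, one_smul, smul_comm]
  · rw [tA_mul_YA_of_ne h, mul_smul, hx j, hq j h, smul_comm]

theorem IsMonomial.mem_wtSp {v₀ v : M} {n : I →₀ ℤ} (h : IsMonomial (XA k I) (YA k I) v₀ n v)
    {p : I → k} (h₀ : v₀ ∈ wtSp k I M p) :
    v ∈ wtSp k I M fun j => p j + n j := by
  induction h with
  | base => simpa using h₀
  | X_smul i h hv ih =>
    refine XA_smul_mem_wtSp ih i ?_ fun j hj => ?_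
    · simp [add_assoc]
    · simp [Finsupp.single_eq_of_ne hj]
  | Y_smul i h hv ih =>
    refine YA_smul_mem_wtSp ih i ?_ fun j hj => ?_
    · simp [add_sub_assoc]
    · simp [Finsupp.single_eq_of_ne hj]

variable (k I) in
/-- The span of the vectors obtained from `v₀` by monomials in the `X i` and `Y i`. -/
def monomialSpan (v₀ : M) : Submodule k M :=
  Submodule.span k {v | ∃ n : I →₀ ℤ, IsMonomial (XA k I) (YA k I) v₀ n v}

theorem smul_mem_monomialSpan {v₀ : M} {p : I → k} (h₀ : v₀ ∈ wtSp k I M p) (a : Weyl k I) :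
    ∀ x ∈ monomialSpan k I v₀,
      a • x ∈ monomialSpan k I v₀ := by
  have key (b : Weyl k I) (hb : ∀ (n : I →₀ ℤ) v, IsMonomial (XA k I) (YA k I) v₀ n v →
      b • v ∈ monomialSpan k I v₀) :
      ∀ x ∈ monomialSpan k I v₀,
        b • x ∈ monomialSpan k I v₀ := by
    intro x hx
    induction hx using Submodule.span_induction with
    | mem x hx => exact hb _ _ hx.choose_spec
    | zero => rw [smul_zero]; exact zero_mem _
    | add x y _ _ hx hy => rw [smul_add]; exact add_mem hx hy
    | smul c x _ hx => rw [smul_comm]; exact Submodule.smul_mem _ c hx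
  induction a using weyl_induction with
  | hX i =>
    refine key _ fun n v hv => ?_
    rcases le_or_gt 0 (n i) with h | h
    · exact Submodule.subset_span ⟨_, hv.X_smul i h⟩
    · obtain ⟨w, hw, rfl⟩ := hv.exists_eq_Y_smul h
      rw [← mul_smul, ← tA, hw.mem_wtSp h₀ i]
      exact Submodule.smul_mem _ _ (Submodule.subset_span ⟨_, hw⟩)
  | hY i =>
    refine key _ fun n v hv => ?_
    rcases le_or_gt (n i) 0 with h | h
    · exact Submodule.subset_span ⟨_, hv.Y_smul i h⟩
    · obtain ⟨w, hw, rfl⟩ := hv.exists_eq_X_smul h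
      rw [← mul_smul, YA_mul_XA_self, ← tA, add_smul, one_smul, hw.mem_wtSp h₀ i]
      have hw' : w ∈ monomialSpan k I v₀ := Submodule.subset_span ⟨_, hw⟩
      exact add_mem (Submodule.smul_mem _ _ hw') hw'
  | halg c =>
    intro x hx
    rw [algebraMap_smul]
    exact Submodule.smul_mem _ c hx
  | hadd a b ha hb => exact fun x hx => by rw [add_smul]; exact add_mem (ha x hx) (hb x hx)
  | hmul a b ha hb => exact fun x hx => by rw [mul_smul]; exact ha _ (hb x hx)

theorem monomialSpan_eq_top {v₀ : M} {p : I → k} (h₀ : v₀ ∈ wtSp k I M p)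
    (hgen : ∀ x : M, ∃ a : Weyl k I, a • v₀ = x) :
    monomialSpan k I v₀ = ⊤ := by
  refine eq_top_iff.2 fun x _ => ?_
  obtain ⟨a, rfl⟩ := hgen x
  exact smul_mem_monomialSpan h₀ a _ (Submodule.subset_span ⟨0, .base⟩)

theorem commute_of_mem_adjoin_tA {a b : Weyl k I}
    (ha : a ∈ Algebra.adjoin k (Set.range (tA k I)))
    (hb : b ∈ Algebra.adjoin k (Set.range (tA k I))) : Commute a b := by
  refine Algebra.commute_of_mem_adjoin_of_forall_mem_commute hb ?_
  rintro _ ⟨j, rfl⟩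
  refine (Algebra.commute_of_mem_adjoin_of_forall_mem_commute ha ?_).symm
  rintro _ ⟨i, rfl⟩
  exact tA_mul_tA j i

/-- If each `t i` acts on the functional `φ` by the scalar `p i`, then on each vector the projection
`x ↦ φ x • v₀` onto the weight space is given by a polynomial in the `t i`. -/
theorem exists_weight_projector [CharZero k] {v₀ : M} {p : I → k} (h₀ : v₀ ∈ wtSp k I M p)
    (hgen : ∀ x : M, ∃ a : Weyl k I, a • v₀ = x) {φ : M →ₗ[k] k} (hφ₀ : φ v₀ = 1)
    (hφ : ∀ i x, φ (tA k I i • x) = p i * φ x) (x : M) :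
    ∃ a ∈ Algebra.adjoin k (Set.range (tA k I)),
      (∀ v ∈ wtSp k I M p, a • v = v) ∧ a • x = φ x • v₀ := by
  have hx : x ∈ monomialSpan k I v₀ := by
    rw [monomialSpan_eq_top h₀ hgen]; trivial
  induction hx using Submodule.span_induction with
  | mem x hx =>
    obtain ⟨n, hn⟩ := hx
    by_cases h : n = 0
    · obtain rfl := hn.eq_of_eq_zero h
      exact ⟨1, one_mem _, fun v _ => one_smul _ v, by rw [hφ₀, one_smul, one_smul]⟩
    · obtain ⟨i, hi⟩ := Finsupp.ne_iff.1 h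
      have hi' : (n i : k) ≠ 0 := Int.cast_ne_zero.2 hi
      have ht : tA k I i • x = (p i + n i) • x := hn.mem_wtSp h₀ i
      have hφx : φ x = 0 := by
        have := hφ i x
        rw [ht, map_smul, smul_eq_mul, add_mul, add_eq_left] at this
        exact (mul_eq_zero.1 this).resolve_left hi'
      refine ⟨(-(n i : k)⁻¹) • (tA k I i - algebraMap k _ (p i + n i)), ?_, fun v hv => ?_, ?_⟩
      · exact Subalgebra.smul_mem _ (sub_mem (Algebra.subset_adjoin (Set.mem_range_self i))
          (Subalgebra.algebraMap_mem _ _)) _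
      · rw [smul_assoc, sub_smul, hv i, algebraMap_smul, ← sub_smul, smul_smul]
        simp [hi']
      · rw [smul_assoc, sub_smul, ht, algebraMap_smul, sub_self, smul_zero, hφx, zero_smul]
  | zero => exact ⟨1, one_mem _, fun v _ => one_smul _ v, by simp⟩
  | add x y _ _ hx hy =>
    obtain ⟨a, ha, hap, hax⟩ := hx
    obtain ⟨b, hb, hbp, hby⟩ := hy
    refine ⟨a * b, mul_mem ha hb, fun v hv => by rw [mul_smul, hbp v hv, hap v hv], ?_⟩
    rw [smul_add, mul_smul _ _ y, hby, (commute_of_mem_adjoin_tA ha hb).eq, mul_smul, hax,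
      smul_comm, smul_comm a, hap _ h₀, hbp _ h₀, map_add, add_smul]
  | smul c x _ hx =>
    obtain ⟨a, ha, hap, hax⟩ := hx
    exact ⟨a, ha, hap, by rw [smul_comm, hax, map_smul, smul_assoc]⟩

/-- A module generated by a vector `v₀` of weight `p` which carries a nonzero functional of weight
`p` has only scalar endomorphisms, is indecomposable, and has a largest proper submodule. -/
theorem local_of_weight_functional [CharZero k] {v₀ : M} {p : I → k} (h₀ : v₀ ∈ wtSp k I M p)
    (hgen : ∀ x : M, ∃ a : Weyl k I, a • v₀ = x) {φ : M →ₗ[k] k} (hφ₀ : φ v₀ = 1)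
    (hφ : ∀ i x, φ (tA k I i • x) = p i * φ x) {N : Submodule (Weyl k I) M}
    (hN : N = sSup {S : Submodule (Weyl k I) M | ∀ x ∈ S, x ∈ wtSp k I M p → x = 0}) :
    (∀ f : M →ₗ[Weyl k I] M, ∃ c : k, ∀ x, f x = c • x) ∧
    (∀ S T : Submodule (Weyl k I) M, IsCompl S T → S = ⊥ ∨ T = ⊥) ∧
    N ≠ ⊤ ∧ (∀ S : Submodule (Weyl k I) M, S ≠ ⊤ → S ≤ N) := by
  have hproj := exists_weight_projector h₀ hgen hφ₀ hφ
  have hwt : ∀ x ∈ wtSp k I M p, x = φ x • v₀ := fun x hx => by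
    obtain ⟨a, -, hap, hax⟩ := hproj x
    rw [← hax, hap x hx]
  have hmem : ∀ (S : Submodule (Weyl k I) M), ∀ x ∈ S, φ x • v₀ ∈ S :=
    fun S x hx => by
      obtain ⟨a, -, -, hax⟩ := hproj x
      exact hax ▸ S.smul_mem a hx
  have hker : ∀ x ∈ N, φ x = 0 := fun x hx => by
    rw [hN, sSup_eq_iSup'] at hx
    refine Submodule.iSup_induction _ (motive := fun x => φ x = 0) hx (fun S y hy => ?_)
      (map_zero φ) fun y z hy hz => ?_
    · have := congr(φ $(S.2 _ (hmem _ y hy) (Submodule.smul_mem _ _ h₀)))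
      simpa [hφ₀] using this
    · rw [map_add, hy, hz, add_zero]
  have hNp : N ≠ ⊤ := fun h => by
    have := hker v₀ (h ▸ Submodule.mem_top)
    exact one_ne_zero (hφ₀.symm.trans this)
  have hle : ∀ S : Submodule (Weyl k I) M, S ≠ ⊤ → S ≤ N := by
    intro S hS
    refine hN ▸ le_sSup fun x hx hxp => ?_
    by_contra hne
    have hφx : φ x ≠ 0 := fun h => hne (by rw [hwt x hxp, h, zero_smul])
    have hv₀ : v₀ ∈ S := by
      have := Submodule.smul_of_tower_mem S (φ x)⁻¹ (hmem S x hx)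
      rwa [smul_smul, inv_mul_cancel₀ hφx, one_smul] at this
    refine hS (eq_top_iff.2 fun y _ => ?_)
    obtain ⟨a, rfl⟩ := hgen y
    exact S.smul_mem a hv₀
  refine ⟨fun f => ?_, fun S T hST => ?_, hNp, hle⟩
  · refine ⟨φ (f v₀), fun x => ?_⟩
    have hf : f v₀ = φ (f v₀) • v₀ := hwt _ fun i => by
      rw [← map_smul, h₀ i, f.map_smul_of_tower]
    obtain ⟨a, rfl⟩ := hgen x
    rw [map_smul, smul_comm, ← hf]
  · by_contra! h
    refine hNp (top_le_iff.1 (hST.sup_eq_top ▸ sup_le (hle S fun hS => ?_) (hle T fun hT => ?_)))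
    · exact h.2 (eq_bot_iff.2 (by simpa [hS] using hST.inf_eq_bot.le))
    · exact h.1 (eq_bot_iff.2 (by simpa [hT] using hST.inf_eq_bot.le))

theorem mkQ_one_mem_wtSp (p : I → k) :
    (Jp k I p).mkQ 1 ∈ wtSp k I (Weyl k I ⧸ Jp k I p) p := by
  intro i
  have h : tA k I i - p i • (1 : Weyl k I) ∈ Jp k I p := Submodule.subset_span ⟨i, rfl⟩
  have h' := (Submodule.Quotient.eq (Jp k I p)).2 h
  rw [← map_smul, smul_eq_mul, mul_one]
  exact h'

theorem exists_smul_mkQ_one (p : I → k) (x : Weyl k I ⧸ Jp k I p) :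
    ∃ a : Weyl k I, a • (Jp k I p).mkQ 1 = x := by
  obtain ⟨a, rfl⟩ := (Jp k I p).mkQ_surjective x
  exact ⟨a, by rw [← map_smul, smul_eq_mul, mul_one]⟩

/-- Every `A`-module endomorphism of `P(p)` is a scalar, `P(p)` is
indecomposable, and `N(p)` is a proper submodule containing every proper submodule,
i.e. `P(p)` has a unique maximal proper submodule. -/
theorem Pp_local [IsAlgClosed k] [CharZero k] [Infinite I] (p : I → k) :
    (∀ f : (Weyl k I ⧸ Jp k I p) →ₗ[Weyl k I] (Weyl k I ⧸ Jp k I p),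
      ∃ c : k, ∀ x, f x = c • x) ∧
    (∀ S T : Submodule (Weyl k I) (Weyl k I ⧸ Jp k I p), IsCompl S T → S = ⊥ ∨ T = ⊥) ∧
    Np k I p ≠ ⊤ ∧
    (∀ S : Submodule (Weyl k I) (Weyl k I ⧸ Jp k I p), S ≠ ⊤ → S ≤ Np k I p) := by
  obtain ⟨φ, hφ₀, hφ⟩ := exists_weight_functional_quotient p
  exact local_of_weight_functional (mkQ_one_mem_wtSp p) (exists_smul_mkQ_one p) hφ₀ hφ rfl
end
end

section
/- Let p, s : I → k and suppose algebra homomorphisms ρ_p and ρ_s as above both exist, giving simple A-modules L(p) = N_p/N''_p and L(s) = N_s/N''_s. Then L(p) and L(s) are isomorphic as A-modules if and only if s ∈ p̄. -/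
set_option synthInstance.maxHeartbeats 1000000
set_option maxHeartbeats 4000000

noncomputable section

open MvPolynomial

universe u v

variable (k : Type u) (I : Type v) [Field k]

/-- The shift operator `S i : e_v ↦ e_{v + δ i}` on the free module `(I →₀ ℤ) →₀ k`. -/
def Sop (i : I) : Module.End k ((I →₀ ℤ) →₀ k) :=
  Finsupp.lmapDomain k k (fun v => v + Finsupp.single i 1)

/-- The twisted derivative operator `D i : e_v ↦ (p i + v i) • e_{v - δ i}`. -/
def Dop (p : I → k) (i : I) : Module.End k ((I →₀ ℤ) →₀ k) :=
  Finsupp.lsum k fun v =>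
    LinearMap.toSpanSingleton k ((I →₀ ℤ) →₀ k)
      ((p i + ((v i : ℤ) : k)) • Finsupp.single (v - Finsupp.single i 1) (1 : k))

/-- The space `V = (I →₀ ℤ) →₀ k` regarded as a module over the Weyl algebra through a
homomorphism `ρ : A →ₐ[k] End_k V`; this is the module `B(p)` when `ρ = ρ_p`. -/
def BMod (ρ : Weyl k I →ₐ[k] Module.End k ((I →₀ ℤ) →₀ k)) : Type (max u v) :=
  (I →₀ ℤ) →₀ k

variable {k I} in
instance (ρ : Weyl k I →ₐ[k] Module.End k ((I →₀ ℤ) →₀ k)) : AddCommGroup (BMod k I ρ) :=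
  inferInstanceAs (AddCommGroup ((I →₀ ℤ) →₀ k))

variable {k I} in
instance (ρ : Weyl k I →ₐ[k] Module.End k ((I →₀ ℤ) →₀ k)) : Module k (BMod k I ρ) :=
  inferInstanceAs (Module k ((I →₀ ℤ) →₀ k))

variable {k I} in
instance (ρ : Weyl k I →ₐ[k] Module.End k ((I →₀ ℤ) →₀ k)) :
    Module (Weyl k I) (BMod k I ρ) where
  smul a x := ρ a x
  one_smul x := by show ρ 1 x = x; rw [map_one]; rfl
  mul_smul a b x := by show ρ (a * b) x = ρ a (ρ b x); rw [map_mul]; rfl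
  smul_zero a := map_zero (ρ a)
  smul_add a x y := map_add (ρ a) x y
  add_smul a b x := by show ρ (a + b) x = ρ a x + ρ b x; rw [map_add]; rfl
  zero_smul x := by show ρ 0 x = 0; rw [map_zero]; rfl

variable {k I} in
instance (ρ : Weyl k I →ₐ[k] Module.End k ((I →₀ ℤ) →₀ k)) :
    IsScalarTower k (Weyl k I) (BMod k I ρ) :=
  ⟨fun c a x => by
    show ρ (c • a) x = c • (ρ a x)
    rw [map_smul]
    rfl⟩

/-- The basis vector `e_v` of `B(p)`. -/
def eV (ρ : Weyl k I →ₐ[k] Module.End k ((I →₀ ℤ) →₀ k)) (v : I →₀ ℤ) : BMod k I ρ :=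
  Finsupp.single v 1

/-- `c` is a nonnegative integer. -/
def IsNonnegInt (c : k) : Prop := ∃ n : ℕ, c = n

/-- `c` is a negative integer. -/
def IsNegInt (c : k) : Prop := ∃ m : ℤ, m < 0 ∧ c = m

/-- The index set `S` of the submodule `N ⊆ B(p)`. -/
def Sset (p : I → k) : Set (I →₀ ℤ) :=
  {v | ∀ i, IsNonnegInt k (p i) → IsNonnegInt k (p i + ((v i : ℤ) : k))}

/-- The index set `S''` of the submodule `N'' ⊆ N`. -/
def Sset'' (p : I → k) : Set (I →₀ ℤ) :=
  {v | v ∈ Sset k I p ∧ ∃ i, IsNegInt k (p i) ∧ IsNonnegInt k (p i + ((v i : ℤ) : k))}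

/-- The `k`-span `N` of the `e_v`, `v ∈ S`. -/
def Nspan (p : I → k) (ρ : Weyl k I →ₐ[k] Module.End k ((I →₀ ℤ) →₀ k)) :
    Submodule k (BMod k I ρ) :=
  Submodule.span k {x | ∃ v ∈ Sset k I p, x = eV k I ρ v}

/-- The `k`-span `N''` of the `e_v`, `v ∈ S''`. -/
def Nspan'' (p : I → k) (ρ : Weyl k I →ₐ[k] Module.End k ((I →₀ ℤ) →₀ k)) :
    Submodule k (BMod k I ρ) :=
  Submodule.span k {x | ∃ v ∈ Sset'' k I p, x = eV k I ρ v}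

/-- The set `p̄` of weights of `L(p)`: all `m = p + v`, `v` finitely supported integral, such
that negative-integrality and nonnegative-integrality of coordinates is inherited from `p`. -/
def pbar (p : I → k) : Set (I → k) :=
  {m | (∃ v : I →₀ ℤ, m = fun i => p i + ((v i : ℤ) : k)) ∧
    ∀ i, (IsNegInt k (p i) → IsNegInt k (m i)) ∧ (IsNonnegInt k (p i) → IsNonnegInt k (m i))}

section Auxiliary

variable {k I}

/-- The relabelling `e_w ↦ e_{w - v}` of the standard basis of `(I →₀ ℤ) →₀ k`. -/
def shiftEquiv (v : I →₀ ℤ) : ((I →₀ ℤ) →₀ k) ≃ₗ[k] ((I →₀ ℤ) →₀ k) :=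
  Finsupp.domLCongr (Equiv.subRight v)

lemma shiftEquiv_single (v w : I →₀ ℤ) (c : k) :
    shiftEquiv v (Finsupp.single w c) = Finsupp.single (w - v) c := by
  simp [shiftEquiv]

lemma shiftEquiv_apply (v w : I →₀ ℤ) (x : (I →₀ ℤ) →₀ k) :
    shiftEquiv v x w = x (w + v) := by
  simp [shiftEquiv, Finsupp.domLCongr_apply, Finsupp.equivMapDomain_apply]

lemma Sop_single (i : I) (w : I →₀ ℤ) (c : k) :
    Sop k I i (Finsupp.single w c) = Finsupp.single (w + Finsupp.single i 1) c := by
  simp [Sop, Finsupp.lmapDomain_apply, Finsupp.mapDomain_single]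

lemma Dop_single (p : I → k) (i : I) (w : I →₀ ℤ) (c : k) :
    Dop k I p i (Finsupp.single w c) =
      Finsupp.single (w - Finsupp.single i 1) (c * (p i + ((w i : ℤ) : k))) := by
  rw [Dop, Finsupp.lsum_single, LinearMap.toSpanSingleton_apply, smul_smul,
    Finsupp.smul_single, smul_eq_mul, mul_one]

lemma shiftEquiv_Sop (v : I →₀ ℤ) (i : I) (x : (I →₀ ℤ) →₀ k) :
    shiftEquiv v (Sop k I i x) = Sop k I i (shiftEquiv v x) := by
  induction x using Finsupp.induction_linear with
  | zero => simp
  | add x y hx hy => simp only [map_add, hx, hy]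
  | single w c =>
    rw [Sop_single, shiftEquiv_single, shiftEquiv_single, Sop_single, add_sub_right_comm]

lemma shiftEquiv_Dop {p s : I → k} {v : I →₀ ℤ} (hs : ∀ i, s i = p i + ((v i : ℤ) : k))
    (i : I) (x : (I →₀ ℤ) →₀ k) :
    shiftEquiv v (Dop k I p i x) = Dop k I s i (shiftEquiv v x) := by
  induction x using Finsupp.induction_linear with
  | zero => simp
  | add x y hx hy => simp only [map_add, hx, hy]
  | single w c =>
    rw [Dop_single, shiftEquiv_single, shiftEquiv_single, Dop_single, sub_right_comm, hs]
    congr 2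
    simp

lemma Sop_Dop_apply (p : I → k) (i : I) (x : (I →₀ ℤ) →₀ k) (w : I →₀ ℤ) :
    Sop k I i (Dop k I p i x) w = (p i + ((w i : ℤ) : k)) * x w := by
  induction x using Finsupp.induction_linear with
  | zero => simp
  | add x y hx hy => simp only [map_add, Finsupp.add_apply, hx, hy, mul_add]
  | single u c =>
    rw [Dop_single, Sop_single, sub_add_cancel]
    by_cases h : u = w
    · subst h; simp [mul_comm]
    · simp [Finsupp.single_eq_of_ne' h]

/-- Two representations of the Weyl algebra intertwined on generators are intertwined. -/
lemma Weyl.intertwine {M N : Type*} [AddCommGroup M] [Module k M] [AddCommGroup N] [Module k N]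
    (ρ : Weyl k I →ₐ[k] Module.End k M) (σ : Weyl k I →ₐ[k] Module.End k N) (f : M →ₗ[k] N)
    (hX : ∀ i x, f (ρ (XA k I i) x) = σ (XA k I i) (f x))
    (hY : ∀ i x, f (ρ (YA k I i) x) = σ (YA k I i) (f x)) (a : Weyl k I) (x : M) :
    f (ρ a x) = σ a (f x) := by
  obtain ⟨a, ha⟩ := a
  induction ha using Algebra.adjoin_induction generalizing x with
  | mem a ha =>
    rcases ha with ⟨i, rfl⟩ | ⟨i, rfl⟩
    · exact hX i x
    · exact hY i x
  | algebraMap c =>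
    change f (ρ (algebraMap k (Weyl k I) c) x) = σ (algebraMap k (Weyl k I) c) (f x)
    simp [AlgHom.commutes, Module.algebraMap_end_apply]
  | add a b ha hb iha ihb =>
    change f (ρ ((⟨a, ha⟩ : Weyl k I) + ⟨b, hb⟩) x) = σ ((⟨a, ha⟩ : Weyl k I) + ⟨b, hb⟩) (f x)
    simp only [map_add, LinearMap.add_apply, iha, ihb]
  | mul a b ha hb iha ihb =>
    change f (ρ ((⟨a, ha⟩ : Weyl k I) * ⟨b, hb⟩) x) = σ ((⟨a, ha⟩ : Weyl k I) * ⟨b, hb⟩) (f x)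
    simp only [map_mul, Module.End.mul_apply, iha, ihb]

/-- The coefficient of `e_w` in an element of `B(p)`. -/
def BMod.coeff {ρ : Weyl k I →ₐ[k] Module.End k ((I →₀ ℤ) →₀ k)} (x : BMod k I ρ)
    (w : I →₀ ℤ) : k :=
  (show (I →₀ ℤ) →₀ k from x) w

lemma BMod.coeff_tA_sub_smul {ρ : Weyl k I →ₐ[k] Module.End k ((I →₀ ℤ) →₀ k)} {p : I → k}
    (hX : ∀ i, ρ (XA k I i) = Sop k I i) (hY : ∀ i, ρ (YA k I i) = Dop k I p i)
    (i : I) (c : k) (x : BMod k I ρ) (w : I →₀ ℤ) :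
    ((tA k I i - algebraMap k (Weyl k I) c) • x).coeff w =
      (p i + ((w i : ℤ) : k) - c) * x.coeff w := by
  change (ρ (tA k I i - algebraMap k (Weyl k I) c) x) w = _
  rw [map_sub, tA, map_mul, hX, hY, AlgHom.commutes, sub_mul]
  exact congrArg (· - c * x.coeff w) (Sop_Dop_apply p i x w)

lemma coeff_eV_zero_ne {ρ : Weyl k I →ₐ[k] Module.End k ((I →₀ ℤ) →₀ k)} {w : I →₀ ℤ}
    (hw : (eV k I ρ 0).coeff w ≠ 0) : w = 0 := by
  by_contra h
  exact hw (Finsupp.single_eq_of_ne h)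

lemma mem_span_eV_iff {ρ : Weyl k I →ₐ[k] Module.End k ((I →₀ ℤ) →₀ k)} (S : Set (I →₀ ℤ))
    (x : BMod k I ρ) :
    x ∈ Submodule.span k {y | ∃ v ∈ S, y = eV k I ρ v} ↔ ∀ w, x.coeff w ≠ 0 → w ∈ S := by
  have h : {y : BMod k I ρ | ∃ v ∈ S, y = eV k I ρ v} =
      (fun v => (Finsupp.single v 1 : (I →₀ ℤ) →₀ k)) '' S := by
    ext y
    exact exists_congr fun v => and_congr_right fun _ => eq_comm
  rw [h]
  change (show (I →₀ ℤ) →₀ k from x) ∈ Submodule.span k ((fun v => (Finsupp.single v 1 : (I →₀ ℤ) →₀ k)) '' S) ↔ _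
  rw [← Finsupp.supported_eq_span_single, Finsupp.mem_supported]
  simp only [Set.subset_def, Finset.mem_coe]
  exact forall_congr' fun w => imp_congr_left Finsupp.mem_support_iff

lemma isNegInt_or_isNonnegInt (m : ℤ) : IsNegInt k (m : k) ∨ IsNonnegInt k (m : k) := by
  rcases lt_or_ge m 0 with h | h
  · exact Or.inl ⟨m, h, rfl⟩
  · lift m to ℕ using h
    exact Or.inr ⟨m, by simp⟩

lemma IsNegInt.not_isNonnegInt [CharZero k] {c : k} (h : IsNegInt k c) : ¬ IsNonnegInt k c := by
  rintro ⟨n, rfl⟩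
  obtain ⟨m, hm, h⟩ := h
  have : (n : ℤ) = m := by exact_mod_cast h
  omega

lemma IsNegInt.add_intCast {c : k} (h : IsNegInt k c) (m : ℤ) :
    IsNegInt k (c + m) ∨ IsNonnegInt k (c + m) := by
  obtain ⟨n, -, rfl⟩ := h
  exact_mod_cast isNegInt_or_isNonnegInt (k := k) (n + m)

lemma IsNonnegInt.add_intCast {c : k} (h : IsNonnegInt k c) (m : ℤ) :
    IsNegInt k (c + m) ∨ IsNonnegInt k (c + m) := by
  obtain ⟨n, rfl⟩ := h
  exact_mod_cast isNegInt_or_isNonnegInt (k := k) (n + m)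

lemma pbar_symm [CharZero k] {p s : I → k} (h : s ∈ pbar k I p) : p ∈ pbar k I s := by
  obtain ⟨⟨v, rfl⟩, h⟩ := h
  refine ⟨⟨-v, by simp⟩, fun i => ⟨fun hi => ?_, fun hi => ?_⟩⟩
  · have := hi.add_intCast (-v i)
    rw [Int.cast_neg, add_neg_cancel_right] at this
    exact this.resolve_right fun h' => hi.not_isNonnegInt ((h i).2 h')
  · have := hi.add_intCast (-v i)
    rw [Int.cast_neg, add_neg_cancel_right] at this
    exact this.resolve_left fun h' => ((h i).1 h').not_isNonnegInt hi

lemma zero_mem_Sset (p : I → k) : (0 : I →₀ ℤ) ∈ Sset k I p := fun i hi => by simpa using hi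

lemma zero_notMem_Sset'' [CharZero k] (p : I → k) : (0 : I →₀ ℤ) ∉ Sset'' k I p := by
  rintro ⟨-, i, hi, h⟩
  exact hi.not_isNonnegInt (by simpa using h)

lemma add_mem_pbar {p : I → k} {v : I →₀ ℤ} (hv : v ∈ Sset k I p) (hv' : v ∉ Sset'' k I p) :
    (fun i => p i + ((v i : ℤ) : k)) ∈ pbar k I p :=
  ⟨⟨v, rfl⟩, fun i => ⟨fun hi => (hi.add_intCast (v i)).resolve_right
    fun h => hv' ⟨hv, i, hi, h⟩, hv i⟩⟩

lemma add_mem_Sset_iff [CharZero k] {p : I → k} {v : I →₀ ℤ}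
    (h : (fun i => p i + ((v i : ℤ) : k)) ∈ pbar k I p) (w : I →₀ ℤ) :
    w + v ∈ Sset k I p ↔ w ∈ Sset k I (fun i => p i + ((v i : ℤ) : k)) := by
  have h' := pbar_symm h
  refine forall_congr' fun i => ?_
  have e : p i + (((w + v) i : ℤ) : k) = p i + ((v i : ℤ) : k) + ((w i : ℤ) : k) := by
    push_cast [Finsupp.add_apply]; ring
  rw [e]
  exact imp_congr_left ⟨(h.2 i).2, (h'.2 i).2⟩

lemma add_mem_Sset''_iff [CharZero k] {p : I → k} {v : I →₀ ℤ}
    (h : (fun i => p i + ((v i : ℤ) : k)) ∈ pbar k I p) (w : I →₀ ℤ) :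
    w + v ∈ Sset'' k I p ↔ w ∈ Sset'' k I (fun i => p i + ((v i : ℤ) : k)) := by
  have h' := pbar_symm h
  refine and_congr (add_mem_Sset_iff h w) (exists_congr fun i => ?_)
  have e : p i + (((w + v) i : ℤ) : k) = p i + ((v i : ℤ) : k) + ((w i : ℤ) : k) := by
    push_cast [Finsupp.add_apply]; ring
  rw [e]
  exact and_congr_left fun _ => ⟨(h.2 i).1, (h'.2 i).1⟩

end Auxiliary

/-- `L(p)` and `L(s)` are isomorphic as modules over the Weyl algebra if
and only if `s ∈ p̄`. -/
theorem Lp_iso_Ls_iff [IsAlgClosed k] [CharZero k] [Infinite I] (p s : I → k)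
    (ρp : Weyl k I →ₐ[k] Module.End k ((I →₀ ℤ) →₀ k))
    (hXp : ∀ i, ρp (XA k I i) = Sop k I i) (hYp : ∀ i, ρp (YA k I i) = Dop k I p i)
    (ρs : Weyl k I →ₐ[k] Module.End k ((I →₀ ℤ) →₀ k))
    (hXs : ∀ i, ρs (XA k I i) = Sop k I i) (hYs : ∀ i, ρs (YA k I i) = Dop k I s i)
    (NAp NAp'' : Submodule (Weyl k I) (BMod k I ρp))
    (hNAp : (NAp : Set (BMod k I ρp)) = (Nspan k I p ρp : Set (BMod k I ρp)))
    (hNAp'' : (NAp'' : Set (BMod k I ρp)) = (Nspan'' k I p ρp : Set (BMod k I ρp)))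
    (NAs NAs'' : Submodule (Weyl k I) (BMod k I ρs))
    (hNAs : (NAs : Set (BMod k I ρs)) = (Nspan k I s ρs : Set (BMod k I ρs)))
    (hNAs'' : (NAs'' : Set (BMod k I ρs)) = (Nspan'' k I s ρs : Set (BMod k I ρs))) :
    Nonempty ((NAp ⧸ Submodule.comap NAp.subtype NAp'') ≃ₗ[Weyl k I]
        (NAs ⧸ Submodule.comap NAs.subtype NAs'')) ↔
      s ∈ pbar k I p := by
  have mNp (x : BMod k I ρp) : x ∈ NAp ↔ ∀ w, x.coeff w ≠ 0 → w ∈ Sset k I p := by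
    rw [← SetLike.mem_coe, hNAp]
    exact mem_span_eV_iff _ x
  have mNp'' (x : BMod k I ρp) :
      x ∈ NAp'' ↔ ∀ w, x.coeff w ≠ 0 → w ∈ Sset'' k I p := by
    rw [← SetLike.mem_coe, hNAp'']
    exact mem_span_eV_iff _ x
  have mNs (x : BMod k I ρs) : x ∈ NAs ↔ ∀ w, x.coeff w ≠ 0 → w ∈ Sset k I s := by
    rw [← SetLike.mem_coe, hNAs]
    exact mem_span_eV_iff _ x
  have mNs'' (x : BMod k I ρs) :
      x ∈ NAs'' ↔ ∀ w, x.coeff w ≠ 0 → w ∈ Sset'' k I s := by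
    rw [← SetLike.mem_coe, hNAs'']
    exact mem_span_eV_iff _ x
  constructor
  · rintro ⟨φ⟩
    have e_mem : eV k I ρp 0 ∈ NAp := (mNp _).2 fun w hw => by
      rw [coeff_eV_zero_ne hw]
      exact zero_mem_Sset p
    have e_notMem : eV k I ρp 0 ∉ NAp'' := fun h =>
      zero_notMem_Sset'' p ((mNp'' _).1 h 0 (by simp [eV, BMod.coeff]))
    let e : NAp := ⟨eV k I ρp 0, e_mem⟩
    obtain ⟨y, hy⟩ := Submodule.Quotient.mk_surjective _ (φ (Submodule.Quotient.mk e))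
    have y_notMem : (y : BMod k I ρs) ∉ NAs'' := fun h => by
      have h0 : (Submodule.Quotient.mk y : NAs ⧸ Submodule.comap NAs.subtype NAs'') = 0 :=
        (Submodule.Quotient.mk_eq_zero _).2 h
      rw [h0, eq_comm, LinearEquiv.map_eq_zero_iff, Submodule.Quotient.mk_eq_zero] at hy
      exact e_notMem hy
    rw [mNs''] at y_notMem
    push Not at y_notMem
    obtain ⟨v, hv, hv''⟩ := y_notMem
    have hvS : v ∈ Sset k I s := (mNs _).1 y.2 v hv
    have weight (i : I) : s i + ((v i : ℤ) : k) = p i := by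
      set a := tA k I i - algebraMap k (Weyl k I) (p i) with ha
      have hae : a • e = 0 := by
        apply Subtype.ext
        refine Finsupp.ext fun w => (BMod.coeff_tA_sub_smul hXp hYp i (p i) (eV k I ρp 0) w).trans ?_
        by_cases hw : (eV k I ρp 0).coeff w = 0
        · rw [hw, mul_zero]; rfl
        · rw [coeff_eV_zero_ne hw, Finsupp.coe_zero, Pi.zero_apply, Int.cast_zero, add_zero,
            sub_self, zero_mul]; rfl
      have hay : (Submodule.Quotient.mk (a • y) : NAs ⧸ Submodule.comap NAs.subtype NAs'') = 0 := by
        rw [Submodule.Quotient.mk_smul, hy, ← map_smul, ← Submodule.Quotient.mk_smul, hae,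
          Submodule.Quotient.mk_zero, map_zero]
      have hmem : a • (y : BMod k I ρs) ∈ NAs'' :=
        (Submodule.Quotient.mk_eq_zero (Submodule.comap NAs.subtype NAs'')).1 hay
      by_contra hne
      refine hv'' ((mNs'' _).1 hmem v ?_)
      rw [ha]
      refine (BMod.coeff_tA_sub_smul hXs hYs i (p i) y v).trans_ne ?_
      exact mul_ne_zero (sub_ne_zero.2 hne) hv
    have := add_mem_pbar hvS hv''
    rw [funext weight] at this
    exact pbar_symm this
  · intro h
    obtain ⟨v, rfl⟩ := h.1
    let f : BMod k I ρp ≃ₗ[Weyl k I] BMod k I ρs :=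
      { (shiftEquiv v : ((I →₀ ℤ) →₀ k) ≃ₗ[k] ((I →₀ ℤ) →₀ k)) with
        map_smul' := fun a x => Weyl.intertwine ρp ρs (shiftEquiv v).toLinearMap
          (fun i x => by rw [hXp, hXs]; exact shiftEquiv_Sop v i x)
          (fun i x => by rw [hYp, hYs]; exact shiftEquiv_Dop (fun _ => rfl) i x) a x }
    have hf (x : BMod k I ρp) (w : I →₀ ℤ) :
        (f x).coeff w = x.coeff (w + v) := shiftEquiv_apply v w x
    have memN (x : BMod k I ρp) : f x ∈ NAs ↔ x ∈ NAp := by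
      rw [mNs, mNp]
      refine (Equiv.addRight v).forall_congr fun w => ?_
      rw [hf, ← add_mem_Sset_iff h w]
      rfl
    have memN'' (x : BMod k I ρp) : f x ∈ NAs'' ↔ x ∈ NAp'' := by
      rw [mNs'', mNp'']
      refine (Equiv.addRight v).forall_congr fun w => ?_
      rw [hf, ← add_mem_Sset''_iff h w]
      rfl
    have map_eq : NAp.map (f : BMod k I ρp →ₗ[Weyl k I] BMod k I ρs) = NAs := by
      ext y
      obtain ⟨x, rfl⟩ := f.surjective y
      rw [memN]
      exact f.injective.mem_set_image (s := (NAp : Set (BMod k I ρp)))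
    refine ⟨Submodule.Quotient.equiv _ _ (f.ofSubmodules NAp NAs map_eq) ?_⟩
    ext y
    obtain ⟨x, rfl⟩ := (f.ofSubmodules NAp NAs map_eq).surjective y
    refine ((f.ofSubmodules NAp NAs map_eq).injective.mem_set_image
      (s := (Submodule.comap NAp.subtype NAp'' : Set NAp))).trans ?_
    exact (memN'' x).symm
end
end
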